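/- arXiv:1903.07496 — 2 statements merged into one kernel-verified Lean document; each statement's English description precedes it below -/
import Mathlib

section
/- Existence for the Hamburger moment problem of a *-algebra state. Let 𝔄 be a unital *-algebra, ω : 𝔄 → ℂ a positive linear functional, and a ∈ 𝔄 with a* = a. Then there exists a finite Borel measure μ on ℝ such that for every n ∈ ℕ the number ω(aⁿ) is real and ∫_ℝ λⁿ dμ(λ) = ω(aⁿ). -/
open scoped ComplexOrder
open Polynomial MeasureTheory Filter Topology
open scoped CompactlySupported

/-- A real polynomial that is nonnegative on `ℝ` is a sum of two squares. -/
theorem Polynomial.exists_eq_sq_add_sq_of_forall_eval_nonneg (p : ℝ[X])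
    (hp : ∀ x, 0 ≤ p.eval x) : ∃ q r : ℝ[X], p = q ^ 2 + r ^ 2 := by
  induction hn : p.natDegree using Nat.strong_induction_on generalizing p with
  | _ n ih =>
  subst hn
  -- it is enough to split off a factor that is a sum of two squares and not identically zero
  have key (s t g : ℝ[X]) (hdeg : 0 < (s ^ 2 + t ^ 2).natDegree) (h0 : p ≠ 0)
      (hfac : p = (s ^ 2 + t ^ 2) * g) : ∃ q r : ℝ[X], p = q ^ 2 + r ^ 2 := by
    have hst : s ^ 2 + t ^ 2 ≠ 0 := left_ne_zero_of_mul (hfac ▸ h0)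
    have hg0 : g ≠ 0 := right_ne_zero_of_mul (hfac ▸ h0)
    have hg : ∀ x, 0 ≤ g.eval x := by
      have hd : Dense {x : ℝ | (s ^ 2 + t ^ 2).IsRoot x}ᶜ :=
        (Set.Finite.countable (finite_setOfPred_isRoot hst)).dense_compl ℝ
      intro x
      refine (isClosed_Ici.preimage g.continuous).closure_subset_iff.2 (fun y hy ↦ ?_) (hd x)
      have h1 := hp y
      have h2 : 0 < (s ^ 2 + t ^ 2).eval y := by
        refine lt_of_le_of_ne ?_ (Ne.symm hy)
        simp only [eval_add, eval_pow]
        positivity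
      rw [hfac, eval_mul] at h1
      exact nonneg_of_mul_nonneg_right h1 h2
    obtain ⟨q, r, hqr⟩ := ih g.natDegree (by rw [hfac, natDegree_mul hst hg0]; omega) g hg rfl
    exact ⟨s * q - t * r, s * r + t * q, by rw [hfac, hqr]; ring⟩
  by_cases hdeg : p.natDegree = 0
  · obtain ⟨c, rfl⟩ := natDegree_eq_zero.1 hdeg
    have hc : 0 ≤ c := by simpa using hp 0
    exact ⟨C √c, 0, by rw [← C_pow, Real.sq_sqrt hc]; simp⟩
  have h0 : p ≠ 0 := by rintro rfl; simp at hdeg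
  obtain ⟨z, hz⟩ := IsAlgClosed.exists_aeval_eq_zero ℂ p
    (by rw [degree_eq_natDegree h0]; exact_mod_cast hdeg)
  by_cases him : z.im = 0
  · obtain ⟨x, rfl⟩ : ∃ x : ℝ, (x : ℂ) = z := ⟨z.re, Complex.ext rfl him.symm⟩
    have hx : p.eval x = 0 := by
      have := aeval_algebraMap_apply ℂ x p
      simp only [Complex.coe_algebraMap] at this
      rw [this] at hz
      simpa using hz
    have hder : p.derivative.eval x = 0 :=
      IsLocalMin.hasDerivAt_eq_zero (Filter.Eventually.of_forall fun y ↦ by rw [hx]; exact hp y)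
        (p.hasDerivAt x)
    have hdvd : (X - C x) ^ 2 ∣ p := (le_rootMultiplicity_iff h0).1
      ((one_lt_rootMultiplicity_iff_isRoot h0).2 ⟨hx, hder⟩)
    obtain ⟨g, hg⟩ := hdvd
    exact key (X - C x) 0 g (by simp) h0 (by rw [hg]; ring)
  · obtain ⟨g, hg⟩ := p.quadratic_dvd_of_aeval_eq_zero_im_ne_zero hz him
    have hquad : X ^ 2 - C (2 * z.re) * X + C (‖z‖ ^ 2) = (X - C z.re) ^ 2 + C z.im ^ 2 := by
      rw [← Complex.normSq_eq_norm_sq, Complex.normSq_apply]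
      simp only [C_add, C_mul, C_ofNat]
      ring
    refine key (X - C z.re) (C z.im) g ?_ h0 (by rw [hg, hquad])
    rw [← C_pow, natDegree_add_C]
    simp

/-- The space of real functions on `ℝ` whose absolute value is bounded by a polynomial. -/
def polynomiallyBounded : Submodule ℝ (ℝ → ℝ) where
  carrier := {f | ∃ p : ℝ[X], ∀ x, |f x| ≤ p.eval x}
  zero_mem' := ⟨0, by simp⟩
  add_mem' := by
    rintro f g ⟨p, hp⟩ ⟨q, hq⟩
    refine ⟨p + q, fun x ↦ ?_⟩
    simpa using (abs_add_le _ _).trans (add_le_add (hp x) (hq x))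
  smul_mem' := by
    rintro c f ⟨p, hp⟩
    refine ⟨|c| • p, fun x ↦ ?_⟩
    simpa [abs_mul] using mul_le_mul_of_nonneg_left (hp x) (abs_nonneg c)

namespace Polynomial

theorem abs_eval_le_eval_sq_add_one (p : ℝ[X]) (x : ℝ) : |p.eval x| ≤ (p ^ 2 + 1).eval x := by
  simp only [eval_add, eval_pow, eval_one]
  nlinarith [sq_abs (p.eval x), sq_nonneg (|p.eval x| - 1)]

/-- A real polynomial as an element of `polynomiallyBounded`. -/
noncomputable def toPolynomiallyBounded : ℝ[X] →ₗ[ℝ] polynomiallyBounded where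
  toFun p := ⟨fun x ↦ p.eval x, p ^ 2 + 1, p.abs_eval_le_eval_sq_add_one⟩
  map_add' p q := by ext; simp
  map_smul' c p := by ext; simp

@[simp]
theorem toPolynomiallyBounded_apply (p : ℝ[X]) (x : ℝ) :
    (p.toPolynomiallyBounded : ℝ → ℝ) x = p.eval x := rfl

theorem toPolynomiallyBounded_injective :
    Function.Injective (toPolynomiallyBounded : ℝ[X] → polynomiallyBounded) :=
  fun _ _ h ↦ Polynomial.funext fun x ↦ congr_fun (congr_arg Subtype.val h) x

/-- A functional on polynomials that is nonnegative on nonnegative polynomials extends to a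
positive functional on the space of polynomially bounded functions. -/
theorem exists_extension_polynomiallyBounded (L : ℝ[X] →ₗ[ℝ] ℝ)
    (hL : ∀ p : ℝ[X], (∀ x, 0 ≤ p.eval x) → 0 ≤ L p) :
    ∃ Φ : polynomiallyBounded →ₗ[ℝ] ℝ, (∀ p : ℝ[X], Φ p.toPolynomiallyBounded = L p) ∧
      ∀ f : polynomiallyBounded, (∀ x, 0 ≤ (f : ℝ → ℝ) x) → 0 ≤ Φ f := by
  let cone : PointedCone ℝ polynomiallyBounded :=
    { carrier := {f | ∀ x, 0 ≤ (f : ℝ → ℝ) x}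
      zero_mem' := fun x ↦ le_rfl
      add_mem' := fun hf hg x ↦ add_nonneg (hf x) (hg x)
      smul_mem' := fun c _ hf x ↦ mul_nonneg c.2 (hf x) }
  let e := LinearEquiv.ofInjective toPolynomiallyBounded toPolynomiallyBounded_injective
  obtain ⟨Φ, hΦ, hpos⟩ := riesz_extension cone
    ⟨LinearMap.range toPolynomiallyBounded, L ∘ₗ e.symm.toLinearMap⟩
    (by
      intro f hf
      obtain ⟨p, rfl⟩ := e.surjective f
      simpa using hL p hf)
    (by
      rintro ⟨f, p, hp⟩
      exact ⟨e p, fun x ↦ by simpa [e] using neg_le_iff_add_nonneg'.1 (abs_le.1 (hp x)).1⟩)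
  refine ⟨Φ, fun p ↦ ?_, hpos⟩
  simpa [e] using hΦ (e p)

/-- **Haviland's theorem** on the real line: a functional on real polynomials that is nonnegative
on nonnegative polynomials is integration against a measure. -/
theorem exists_measure_integral_eval_eq (L : ℝ[X] →ₗ[ℝ] ℝ)
    (hL : ∀ p : ℝ[X], (∀ x, 0 ≤ p.eval x) → 0 ≤ L p) :
    ∃ μ : Measure ℝ, ∀ p : ℝ[X],
      Integrable (fun x ↦ p.eval x) μ ∧ ∫ x, p.eval x ∂μ = L p := by
  obtain ⟨Φ, hΦ, hpos⟩ := exists_extension_polynomiallyBounded L hL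
  have hmono {f g : polynomiallyBounded} (h : ∀ x, (f : ℝ → ℝ) x ≤ (g : ℝ → ℝ) x) :
      Φ f ≤ Φ g := by
    rw [← sub_nonneg, ← map_sub]
    exact hpos _ fun x ↦ sub_nonneg.2 (h x)
  have hmem (f : C_c(ℝ, ℝ)) : ⇑f ∈ polynomiallyBounded := by
    obtain ⟨c, hc⟩ := f.hasCompactSupport.exists_bound_of_continuous f.continuous
    exact ⟨C c, fun x ↦ by simpa using hc x⟩
  let Λ : C_c(ℝ, ℝ) →ₚ[ℝ] ℝ := PositiveLinearMap.mk₀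
    { toFun := fun f ↦ Φ ⟨f, hmem f⟩
      map_add' := fun f g ↦ by rw [← map_add]; rfl
      map_smul' := fun c f ↦ by rw [RingHom.id_apply, ← map_smul]; rfl }
    fun f hf ↦ hpos _ hf
  let cutoff (n : ℕ) (x : ℝ) : ℝ := max 0 (min 1 (n + 1 - |x|))
  have hcut_nonneg n x : 0 ≤ cutoff n x := le_max_left _ _
  have hcut_le n x : cutoff n x ≤ 1 := max_le zero_le_one (min_le_left _ _)
  have hcut_eq (n : ℕ) (x : ℝ) (h : |x| ≤ n) : cutoff n x = 1 := by
    simp only [cutoff]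
    rw [min_eq_left (by linarith), max_eq_right zero_le_one]
  have hcut_cont n : Continuous (cutoff n) := by fun_prop
  have hcut_supp n : HasCompactSupport (cutoff n) := by
    refine HasCompactSupport.intro (isCompact_Icc (a := -(n + 1 : ℝ)) (b := n + 1)) fun x hx ↦ ?_
    rw [Set.mem_Icc, ← abs_le, not_le] at hx
    exact max_eq_left ((min_le_right _ _).trans (by linarith))
  let trunc (p : ℝ[X]) (n : ℕ) : C_c(ℝ, ℝ) :=
    ⟨⟨fun x ↦ p.eval x * cutoff n x, p.continuous.mul (hcut_cont n)⟩, (hcut_supp n).mul_left⟩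
  have htrunc p n x : trunc p n x = p.eval x * cutoff n x := rfl
  set μ := RealRMK.rieszMeasure Λ
  have hint (p : ℝ[X]) (n : ℕ) : ∫ x, p.eval x * cutoff n x ∂μ = Φ ⟨trunc p n, hmem _⟩ :=
    RealRMK.integral_rieszMeasure Λ (trunc p n)
  have hintegrable (p : ℝ[X]) (n : ℕ) : Integrable (fun x ↦ p.eval x * cutoff n x) μ :=
    (trunc p n).continuous.integrable_of_hasCompactSupport (trunc p n).hasCompactSupport
  have hpt (p : ℝ[X]) (x : ℝ) :
      Tendsto (fun n : ℕ ↦ p.eval x * cutoff n x) atTop (𝓝 (p.eval x)) := by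
    obtain ⟨N, hN⟩ := exists_nat_ge |x|
    refine tendsto_const_nhds.congr' ?_
    filter_upwards [eventually_ge_atTop N] with n hn
    rw [hcut_eq n x (hN.trans (by exact_mod_cast hn)), mul_one]
  have hlim (p : ℝ[X]) : Tendsto (fun n ↦ Φ ⟨trunc p n, hmem _⟩) atTop (𝓝 (L p)) := by
    have hbound (n : ℕ) (x : ℝ) :
        |(n : ℝ) * (p.eval x * (1 - cutoff n x))| ≤ ((p ^ 2 + 1) * X ^ 2).eval x := by
      have hp := p.abs_eval_le_eval_sq_add_one x
      have h0 := (abs_nonneg _).trans hp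
      simp only [eval_mul, eval_pow, eval_X] at hp h0 ⊢
      rcases le_or_gt |x| n with h | h
      · rw [hcut_eq n x h]
        simpa using mul_nonneg h0 (sq_nonneg x)
      · have hn : (n : ℝ) ≤ x ^ 2 := by
          rcases Nat.eq_zero_or_pos n with rfl | hn
          · simpa using sq_nonneg x
          · have : (1 : ℝ) ≤ n := by exact_mod_cast hn
            rw [← sq_abs]; nlinarith
        have h1 : |1 - cutoff n x| ≤ 1 :=
          abs_le.2 ⟨by linarith [hcut_le n x], by linarith [hcut_nonneg n x]⟩
        calc |(n : ℝ) * (p.eval x * (1 - cutoff n x))|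
            = n * (|p.eval x| * |1 - cutoff n x|) := by simp [abs_mul]
          _ ≤ x ^ 2 * ((p ^ 2 + 1).eval x * 1) := by gcongr
          _ = _ := by ring
    have hdist (n : ℕ) :
        (n : ℝ) * |L p - Φ ⟨trunc p n, hmem _⟩| ≤ L ((p ^ 2 + 1) * X ^ 2) := by
      rw [← hΦ, ← hΦ, ← map_sub, ← Nat.abs_cast n, ← abs_mul, ← smul_eq_mul,
        ← map_smul]
      refine abs_le.2 ⟨?_, hmono fun x ↦ ?_⟩
      · rw [← map_neg]
        refine hmono fun x ↦ ?_
        simpa [htrunc, mul_sub] using (abs_le.1 (hbound n x)).1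
      · simpa [htrunc, mul_sub] using (abs_le.1 (hbound n x)).2
    rw [tendsto_iff_dist_tendsto_zero]
    refine squeeze_zero' (Eventually.of_forall fun _ ↦ dist_nonneg) ?_
      (tendsto_const_div_atTop_nhds_zero_nat (L ((p ^ 2 + 1) * X ^ 2)))
    filter_upwards [eventually_gt_atTop 0] with n hn
    rw [le_div_iff₀ (by exact_mod_cast hn), dist_comm, Real.dist_eq, mul_comm]
    exact hdist n
  have hi_of_nonneg (p : ℝ[X]) (hp : ∀ x, 0 ≤ p.eval x) : Integrable (fun x ↦ p.eval x) μ := by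
    refine integrable_of_tendsto (.of_forall (hpt p)) (fun n ↦ (hintegrable p n).1) ?_
    have hle (n : ℕ) : ∫⁻ x, ‖p.eval x * cutoff n x‖ₑ ∂μ ≤ ENNReal.ofReal (L p) := by
      simp_rw [Real.enorm_of_nonneg (mul_nonneg (hp _) (hcut_nonneg n _))]
      rw [← ofReal_integral_eq_lintegral_ofReal (hintegrable p n)
        (.of_forall fun x ↦ mul_nonneg (hp x) (hcut_nonneg n x)), hint, ← hΦ]
      exact ENNReal.ofReal_le_ofReal
        (hmono fun x ↦ mul_le_of_le_one_right (hp x) (hcut_le n x))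
    exact ne_top_of_le_ne_top ENNReal.ofReal_ne_top
      (liminf_le_of_frequently_le' (Frequently.of_forall hle))
  have hi (p : ℝ[X]) : Integrable (fun x ↦ p.eval x) μ :=
    (hi_of_nonneg (p ^ 2 + 1) fun x ↦ (abs_nonneg _).trans (p.abs_eval_le_eval_sq_add_one x)).mono'
      p.continuous.aestronglyMeasurable (.of_forall p.abs_eval_le_eval_sq_add_one)
  refine ⟨μ, fun p ↦ ⟨hi p, tendsto_nhds_unique ?_ (hlim p)⟩⟩
  simp_rw [← hint]
  refine tendsto_integral_of_dominated_convergence (fun x ↦ |p.eval x|)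
    (fun n ↦ (hintegrable p n).1) (hi p).abs (fun n ↦ .of_forall fun x ↦ ?_) (.of_forall (hpt p))
  rw [Real.norm_eq_abs, abs_mul, abs_of_nonneg (hcut_nonneg n x)]
  exact mul_le_of_le_one_right (abs_nonneg _) (hcut_le n x)

end Polynomial

/-- Real polynomials in a self-adjoint element are self-adjoint. -/
theorem IsSelfAdjoint.aeval_map_algebraMap {A : Type*} [Ring A] [Algebra ℂ A] [StarRing A]
    [StarModule ℂ A] {a : A} (ha : IsSelfAdjoint a) (p : ℝ[X]) :
    IsSelfAdjoint (aeval a (p.map (algebraMap ℝ ℂ))) := by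
  induction p using Polynomial.induction_on' with
  | add p q hp hq => simpa using hp.add hq
  | monomial n c =>
    simp only [map_monomial, aeval_monomial, ← Algebra.smul_def]
    exact IsSelfAdjoint.smul (Complex.conj_ofReal c) (ha.pow n)

/-- **Existence for the Hamburger moment problem of a `*`-algebra state.**
If `ω` is a positive linear functional on a unital `*`-algebra `𝔄` and `a = a*`, then there is a
finite Borel measure `μ` on `ℝ` whose `n`-th moment equals `ω(aⁿ)` (in particular each `ω(aⁿ)`
is real). -/
theorem moment_problem_existence {A : Type*} [Ring A] [Algebra ℂ A] [StarRing A] [StarModule ℂ A]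
    (ω : A →ₗ[ℂ] ℂ) (hpos : ∀ a : A, 0 ≤ ω (star a * a)) (a : A) (ha : star a = a) :
    ∃ μ : MeasureTheory.Measure ℝ, MeasureTheory.IsFiniteMeasure μ ∧
      ∀ n : ℕ, ω (a ^ n) = ((∫ x, x ^ n ∂μ : ℝ) : ℂ) := by
  have hsq {b : A} (hb : IsSelfAdjoint b) : 0 ≤ ω (b ^ 2) := by
    simpa [hb.star_eq, sq] using hpos b
  have him (n : ℕ) : (ω (a ^ n)).im = 0 := by
    have hself : IsSelfAdjoint (a ^ n) := IsSelfAdjoint.pow ha n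
    have hexp : (a ^ n + 1) ^ 2 = (a ^ n) ^ 2 + (2 : ℂ) • a ^ n + 1 ^ 2 := by
      rw [ofNat_smul_eq_nsmul]; noncomm_ring
    have h := (Complex.le_def.1 (hsq (hself.add (.one A)))).2
    have h1 := (Complex.le_def.1 (hsq hself)).2
    have h2 := (Complex.le_def.1 (hsq (.one A))).2
    rw [hexp, map_add, map_add, map_smul] at h
    simp at h h1 h2
    linarith
  let L : ℝ[X] →ₗ[ℝ] ℝ :=
    { toFun := fun p ↦ (ω (aeval a (p.map (algebraMap ℝ ℂ)))).re
      map_add' := fun p q ↦ by simp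
      map_smul' := fun c p ↦ by
        simp [Polynomial.smul_eq_C_mul, ← Algebra.smul_def] }
  have hL (p : ℝ[X]) (hp : ∀ x, 0 ≤ p.eval x) : 0 ≤ L p := by
    obtain ⟨q, r, rfl⟩ := p.exists_eq_sq_add_sq_of_forall_eval_nonneg hp
    have hnn (q : ℝ[X]) : 0 ≤ L (q ^ 2) := by
      simpa [L] using (Complex.le_def.1 (hsq (IsSelfAdjoint.aeval_map_algebraMap ha q))).1
    rw [map_add]
    exact add_nonneg (hnn q) (hnn r)
  obtain ⟨μ, hμ⟩ := exists_measure_integral_eval_eq L hL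
  refine ⟨μ, ?_, fun n ↦ ?_⟩
  · have h1 : Integrable (fun _ ↦ (1 : ℝ)) μ := by simpa using (hμ 1).1
    simpa [integrable_const_iff] using h1
  · have hn : ∫ x, x ^ n ∂μ = (ω (a ^ n)).re := by simpa [L] using (hμ (X ^ n)).2
    rw [hn]
    exact Complex.ext rfl (by simpa using him n)
end

section
/- Determinacy of the Gaussian moment problem. Any two finite Borel measures μ and ν on ℝ satisfying ∫_ℝ λⁿ dμ(λ) = π^{-1/2} ∫_ℝ xⁿ e^{−x²} dx = ∫_ℝ λⁿ dν(λ) for every n ∈ ℕ are equal. -/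
open MeasureTheory ProbabilityTheory

lemma lintegral_cosh_mul (μ : Measure ℝ) (hint : ∀ k : ℕ, Integrable (fun x : ℝ ↦ x ^ (2 * k)) μ)
    (t : ℝ) :
    ∫⁻ x, ENNReal.ofReal (Real.cosh (t * x)) ∂μ
      = ∑' k : ℕ, ENNReal.ofReal (t ^ (2 * k) / (2 * k).factorial * ∫ x, x ^ (2 * k) ∂μ) := by
  have hnonneg (k : ℕ) (x : ℝ) : 0 ≤ t ^ (2 * k) / (2 * k).factorial * x ^ (2 * k) := by
    rw [pow_mul, pow_mul]
    positivity
  have hcosh (x : ℝ) : ENNReal.ofReal (Real.cosh (t * x))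
      = ∑' k : ℕ, ENNReal.ofReal (t ^ (2 * k) / (2 * k).factorial * x ^ (2 * k)) := by
    have h : HasSum (fun k : ℕ ↦ t ^ (2 * k) / (2 * k).factorial * x ^ (2 * k))
        (Real.cosh (t * x)) := by
      refine (Real.hasSum_cosh (t * x)).congr_fun fun k ↦ ?_
      rw [mul_pow]
      ring
    rw [← h.tsum_eq, ENNReal.ofReal_tsum_of_nonneg (fun k ↦ hnonneg k x) h.summable]
  simp_rw [hcosh]
  rw [lintegral_tsum fun k ↦ by fun_prop]
  refine tsum_congr fun k ↦ ?_
  rw [← integral_const_mul, ofReal_integral_eq_lintegral_ofReal ((hint k).const_mul _)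
    (.of_forall (hnonneg k))]

lemma integrable_exp_abs_of_integrable_cosh {μ : Measure ℝ} {t : ℝ}
    (h : Integrable (fun x ↦ Real.cosh (t * x)) μ) :
    Integrable (fun x ↦ Real.exp |t * x|) μ := by
  refine (h.const_mul 2).mono' (by fun_prop) (.of_forall fun x ↦ ?_)
  rw [Real.norm_eq_abs, Real.abs_exp, ← Real.cosh_abs, Real.cosh_eq]
  linarith [Real.exp_pos (-|t * x|)]

lemma charFun_eq_tsum_moments {μ : Measure ℝ} {t : ℝ}
    (h : Integrable (fun x ↦ Real.exp |t * x|) μ) :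
    charFun μ t = ∑' n : ℕ, (t * Complex.I) ^ n / n.factorial * ((∫ x, x ^ n ∂μ : ℝ) : ℂ) := by
  have hsum (x : ℝ) : HasSum (fun n : ℕ ↦ |t * x| ^ n / n.factorial) (Real.exp |t * x|) := by
    rw [Real.exp_eq_exp_ℝ]
    exact NormedSpace.expSeries_div_hasSum_exp |t * x|
  have key := hasSum_integral_of_dominated_convergence (μ := μ)
    (F := fun (n : ℕ) (x : ℝ) ↦ (t * Complex.I) ^ n / n.factorial * ((x ^ n : ℝ) : ℂ))
    (f := fun x ↦ Complex.exp (t * x * Complex.I))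
    (fun n x ↦ |t * x| ^ n / n.factorial)
    (fun n ↦ by fun_prop)
    (fun n ↦ .of_forall fun x ↦ by
      simp [abs_mul, mul_pow, div_mul_eq_mul_div])
    (.of_forall fun x ↦ (hsum x).summable)
    (by simpa only [(hsum _).tsum_eq] using h)
    (.of_forall fun x ↦ by
      rw [Complex.exp_eq_exp_ℂ]
      refine (NormedSpace.expSeries_div_hasSum_exp (t * x * Complex.I : ℂ)).congr_fun fun n ↦ ?_
      push_cast
      rw [mul_right_comm, mul_pow _ (x : ℂ)]
      ring)
  rw [charFun_apply_real, ← key.tsum_eq]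
  refine tsum_congr fun n ↦ ?_
  rw [integral_const_mul, integral_complex_ofReal]

/-- A finite measure with exponential moments of all orders is determined by its moments. -/
theorem MeasureTheory.Measure.eq_of_moments_eq {μ γ : Measure ℝ} [IsFiniteMeasure μ]
    [IsFiniteMeasure γ] (hint : ∀ k : ℕ, Integrable (fun x : ℝ ↦ x ^ (2 * k)) μ)
    (hexp : ∀ t : ℝ, Integrable (fun x ↦ Real.exp (t * x)) γ)
    (hmom : ∀ n : ℕ, ∫ x, x ^ n ∂μ = ∫ x, x ^ n ∂γ) : μ = γ := by
  have hcosh_γ (t : ℝ) : Integrable (fun x ↦ Real.cosh (t * x)) γ := by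
    simp_rw [Real.cosh_eq, ← neg_mul]
    exact ((hexp t).add (hexp (-t))).div_const 2
  have hint_γ (k : ℕ) : Integrable (fun x : ℝ ↦ x ^ (2 * k)) γ :=
    integrable_pow_of_integrable_exp_mul one_ne_zero (hexp 1) (hexp (-1)) _
  have hcosh_μ (t : ℝ) : Integrable (fun x ↦ Real.cosh (t * x)) μ := by
    have hnonneg (ρ : Measure ℝ) : 0 ≤ᵐ[ρ] fun x ↦ Real.cosh (t * x) :=
      .of_forall fun x ↦ (Real.cosh_pos _).le
    have hmeas (ρ : Measure ℝ) : AEStronglyMeasurable (fun x ↦ Real.cosh (t * x)) ρ :=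
      (Real.continuous_cosh.comp (continuous_const_mul t)).aestronglyMeasurable
    rw [← lintegral_ofReal_ne_top_iff_integrable (hmeas _) (hnonneg _), lintegral_cosh_mul μ hint]
    simp_rw [hmom]
    rw [← lintegral_cosh_mul γ hint_γ]
    exact (lintegral_ofReal_ne_top_iff_integrable (hmeas _) (hnonneg _)).2 (hcosh_γ t)
  refine Measure.ext_of_charFun (funext fun t ↦ ?_)
  rw [charFun_eq_tsum_moments (integrable_exp_abs_of_integrable_cosh (hcosh_μ t)),
    charFun_eq_tsum_moments (integrable_exp_abs_of_integrable_cosh (hcosh_γ t))]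
  simp_rw [hmom]

lemma integral_pow_gaussianReal_half (n : ℕ) :
    ∫ x, x ^ n ∂(gaussianReal 0 (1 / 2))
      = (Real.sqrt Real.pi)⁻¹ * ∫ x : ℝ, x ^ n * Real.exp (-x ^ 2) := by
  rw [integral_gaussianReal_eq_integral_smul (by simp), ← integral_const_mul]
  refine integral_congr_ae (.of_forall fun x ↦ ?_)
  simp only [gaussianPDFReal, smul_eq_mul]
  have h : (2 : ℝ) * Real.pi * ((1 / 2 : NNReal) : ℝ) = Real.pi := by push_cast; ring
  have h' : (2 : ℝ) * ((1 / 2 : NNReal) : ℝ) = 1 := by push_cast; ring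
  rw [h, h', sub_zero, div_one]
  ring

lemma integral_even_pow_gaussianReal_ne_zero {v : NNReal} (hv : v ≠ 0) (k : ℕ) :
    ∫ x, x ^ (2 * k) ∂(gaussianReal 0 v) ≠ 0 := by
  have := nullSingletonClass_gaussianReal (μ := 0) hv
  have hint : Integrable (fun x : ℝ ↦ x ^ (2 * k)) (gaussianReal 0 v) :=
    integrable_pow_of_integrable_exp_mul one_ne_zero (integrable_exp_mul_gaussianReal 1)
      (integrable_exp_mul_gaussianReal (-1)) _
  intro h
  rw [integral_eq_zero_iff_of_nonneg (fun x ↦ (even_two_mul k).pow_nonneg x) hint] at h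
  have hne : ∀ᵐ x ∂(gaussianReal 0 v), x ≠ 0 := by
    simp [ae_iff]
  obtain ⟨x, hx, hx'⟩ := (h.and hne).exists
  exact pow_ne_zero _ hx' hx

lemma eq_gaussianReal_of_moments {μ : Measure ℝ} [IsFiniteMeasure μ]
    (hμ : ∀ n : ℕ, ∫ t, t ^ n ∂μ = (Real.sqrt Real.pi)⁻¹ * ∫ x, x ^ n * Real.exp (-x ^ 2)) :
    μ = gaussianReal 0 (1 / 2) := by
  have hmom (n : ℕ) : ∫ x, x ^ n ∂μ = ∫ x, x ^ n ∂(gaussianReal 0 (1 / 2)) := by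
    rw [hμ, integral_pow_gaussianReal_half]
  refine Measure.eq_of_moments_eq (fun k ↦ .of_integral_ne_zero ?_)
    integrable_exp_mul_gaussianReal hmom
  rw [hmom]
  exact integral_even_pow_gaussianReal_ne_zero (by simp) k

/-- **Determinacy of the Gaussian moment problem.** Any two finite Borel measures on `ℝ` with
moments `π^{-1/2} ∫ xⁿ e^{−x²} dx` are equal. -/
theorem gaussian_moment_problem_determinate
    (μ ν : Measure ℝ) (hμfin : IsFiniteMeasure μ) (hνfin : IsFiniteMeasure ν)
    (hμ : ∀ n : ℕ, ∫ t, t ^ n ∂μ = (Real.sqrt Real.pi)⁻¹ * ∫ x, x ^ n * Real.exp (-x ^ 2))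
    (hν : ∀ n : ℕ, ∫ t, t ^ n ∂ν = (Real.sqrt Real.pi)⁻¹ * ∫ x, x ^ n * Real.exp (-x ^ 2)) :
    μ = ν := by
  rw [eq_gaussianReal_of_moments hμ, eq_gaussianReal_of_moments hν]
end
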